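/- arXiv:1612.01765 — 2 statements merged into one kernel-verified Lean document; each statement's English description precedes it below -/
import Mathlib

section
/- Let n be a positive integer and let Ψ and Σ be nonempty bounded sets of n×n matrices with nonnegative real entries. Then ρ(Ψ^(1/2) ∘ Σ^(1/2)) ≤ ρ(ΨΣ)^{1/2}, where ρ denotes the generalized spectral radius of a set. -/
open scoped ENNReal NNReal BigOperators

/-- Spectral radius of a real matrix: the spectral radius of the corresponding
complex matrix (equivalently, the maximum modulus of its complex eigenvalues). -/
noncomputable def specRad {n : ℕ} (A : Matrix (Fin n) (Fin n) ℝ) : ℝ≥0∞ :=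
  spectralRadius ℂ (A.map (fun x => (x : ℂ)))

/-- Operator norm of a real `n × n` matrix induced by the Euclidean norm on `ℝⁿ`. -/
noncomputable def opNorm {n : ℕ} (A : Matrix (Fin n) (Fin n) ℝ) : ℝ :=
  ‖LinearMap.toContinuousLinearMap (Matrix.toEuclideanLin A)‖

/-- The weighted Hadamard (Schur) geometric mean `A₁^(α₁) ∘ ⋯ ∘ Aₘ^(αₘ)`. -/
noncomputable def hadWMean {n m : ℕ} (α : Fin m → ℝ)
    (A : Fin m → Matrix (Fin n) (Fin n) ℝ) : Matrix (Fin n) (Fin n) ℝ :=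
  Matrix.of fun x y => ∏ j, (A j x y) ^ (α j)

/-- The ordered product `A 0 * A 1 * ⋯ * A (k-1)`. -/
def matListProd {n k : ℕ} (A : Fin k → Matrix (Fin n) (Fin n) ℝ) :
    Matrix (Fin n) (Fin n) ℝ :=
  (List.ofFn A).prod

/-- The set `Σ^k` of all products of `k` elements of `S`. -/
def setPow {n : ℕ} (S : Set (Matrix (Fin n) (Fin n) ℝ)) (k : ℕ) :
    Set (Matrix (Fin n) (Fin n) ℝ) :=
  {B | ∃ A : Fin k → Matrix (Fin n) (Fin n) ℝ, (∀ i, A i ∈ S) ∧ B = matListProd A}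

/-- The set `Ψ₁ Ψ₂ ⋯ Ψₘ` of products with the `j`-th factor from `Ψ j`. -/
def setProd {n m : ℕ} (Ψ : Fin m → Set (Matrix (Fin n) (Fin n) ℝ)) :
    Set (Matrix (Fin n) (Fin n) ℝ) :=
  {B | ∃ A : Fin m → Matrix (Fin n) (Fin n) ℝ, (∀ j, A j ∈ Ψ j) ∧ B = matListProd A}

/-- The weighted Hadamard geometric mean `Ψ₁^(α₁) ∘ ⋯ ∘ Ψₘ^(αₘ)` of sets. -/
noncomputable def setHadWMean {n m : ℕ} (α : Fin m → ℝ)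
    (Ψ : Fin m → Set (Matrix (Fin n) (Fin n) ℝ)) :
    Set (Matrix (Fin n) (Fin n) ℝ) :=
  {B | ∃ A : Fin m → Matrix (Fin n) (Fin n) ℝ, (∀ j, A j ∈ Ψ j) ∧ B = hadWMean α A}

/-- The generalized spectral radius `ρ(Σ) = limsup_{k→∞} (sup_{A ∈ Σ^k} ρ(A))^{1/k}`. -/
noncomputable def genSpecRad {n : ℕ} (S : Set (Matrix (Fin n) (Fin n) ℝ)) : ℝ≥0∞ :=
  Filter.atTop.limsup fun k : ℕ => (⨆ B ∈ setPow S k, specRad B) ^ (1 / (k : ℝ))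

/-- The joint spectral radius `ρ̂(Σ) = limsup_{k→∞} (sup_{A ∈ Σ^k} ‖A‖)^{1/k}`. -/
noncomputable def jointSpecRad {n : ℕ} (S : Set (Matrix (Fin n) (Fin n) ℝ)) : ℝ≥0∞ :=
  Filter.atTop.limsup fun k : ℕ =>
    (⨆ B ∈ setPow S k, ENNReal.ofReal (opNorm B)) ^ (1 / (k : ℝ))

/-- The Hadamard geometric mean `Ψ^(1/2) ∘ Σ^(1/2)` of two sets of matrices. -/
noncomputable def setHadGeomMeanTwo {n : ℕ}
    (Ψ S : Set (Matrix (Fin n) (Fin n) ℝ)) : Set (Matrix (Fin n) (Fin n) ℝ) :=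
  {C | ∃ A ∈ Ψ, ∃ B ∈ S, C =
    Matrix.of fun x y => (A x y) ^ ((1 : ℝ) / 2) * (B x y) ^ ((1 : ℝ) / 2)}

/-- The product set `ΨΣ = {AB : A ∈ Ψ, B ∈ Σ}`. -/
def setMulTwo {n : ℕ} (Ψ S : Set (Matrix (Fin n) (Fin n) ℝ)) :
    Set (Matrix (Fin n) (Fin n) ℝ) :=
  {C | ∃ A ∈ Ψ, ∃ B ∈ S, C = A * B}

open scoped Pointwise

theorem setPow_eq_pow {n : ℕ} (S : Set (Matrix (Fin n) (Fin n) ℝ)) (k : ℕ) :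
    setPow S k = S ^ k := by
  ext B
  rw [Set.mem_pow]
  constructor
  · rintro ⟨A, hA, rfl⟩
    exact ⟨fun i => ⟨A i, hA i⟩, rfl⟩
  · rintro ⟨f, rfl⟩
    exact ⟨fun i => f i, fun i => (f i).2, rfl⟩

theorem setMulTwo_eq_mul {n : ℕ} (Ψ S : Set (Matrix (Fin n) (Fin n) ℝ)) :
    setMulTwo Ψ S = Ψ * S := by
  ext C
  simp only [setMulTwo, Set.mem_ofPred_eq, Set.mem_mul, eq_comm]

theorem spectralRadius_mul_comm_le {A : Type*} [Ring A] [Algebra ℂ A] (a b : A) :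
    spectralRadius ℂ (a * b) ≤ spectralRadius ℂ (b * a) := by
  refine iSup₂_le fun k hk => ?_
  by_cases h0 : k = 0
  · simp [h0]
  · have h : k ∈ spectrum ℂ (b * a) \ {0} := by
      rw [← spectrum.nonzero_mul_comm]
      exact ⟨hk, h0⟩
    exact le_iSup₂_of_le k h.1 le_rfl

theorem map_ofReal_mul {n : ℕ} (A B : Matrix (Fin n) (Fin n) ℝ) :
    (A * B).map (fun x => (x : ℂ)) = A.map (fun x => (x : ℂ)) * B.map (fun x => (x : ℂ)) :=
  Matrix.map_mul (f := Complex.ofRealHom)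

theorem map_ofReal_pow {n : ℕ} (A : Matrix (Fin n) (Fin n) ℝ) (j : ℕ) :
    (A ^ j).map (fun x => (x : ℂ)) = A.map (fun x => (x : ℂ)) ^ j :=
  map_pow (Complex.ofRealHom.mapMatrix (m := Fin n)) A j

theorem specRad_mul_comm_le {n : ℕ} (A B : Matrix (Fin n) (Fin n) ℝ) :
    specRad (A * B) ≤ specRad (B * A) := by
  simp only [specRad, map_ofReal_mul]
  exact spectralRadius_mul_comm_le _ _

section Norm

attribute [local instance] Matrix.linftyOpNormedRing Matrix.linftyOpNormedAlgebra

theorem row_sum_le_nnnorm {n : ℕ} (A : Matrix (Fin n) (Fin n) ℝ) (x : Fin n) :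
    ∑ y, ‖A x y‖₊ ≤ ‖A.map (fun x => (x : ℂ))‖₊ := by
  rw [Matrix.linfty_opNNNorm_def]
  refine le_trans (le_of_eq ?_)
    (Finset.le_sup (f := fun i => ∑ j, ‖A.map (fun x => (x : ℂ)) i j‖₊) (Finset.mem_univ x))
  simp

theorem specRad_ne_top {n : ℕ} (A : Matrix (Fin n) (Fin n) ℝ) : specRad A ≠ ⊤ := by
  refine ne_top_of_le_ne_top ?_
    (spectrum.spectralRadius_le_pow_nnnorm_pow_one_div ℂ (A.map (fun x => (x : ℂ))) 0)
  simp [ENNReal.mul_eq_top]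

end Norm

/-- `M`, `P`, `Q` are entrywise nonnegative and `M` is dominated entrywise by the Hadamard
geometric mean of `P` and `Q`. -/
structure HadDominated {n : ℕ} (M P Q : Matrix (Fin n) (Fin n) ℝ) : Prop where
  nonneg : ∀ x y, 0 ≤ M x y
  nonneg_left : ∀ x y, 0 ≤ P x y
  nonneg_right : ∀ x y, 0 ≤ Q x y
  sq_le : ∀ x y, M x y ^ 2 ≤ P x y * Q x y

namespace HadDominated

variable {n : ℕ} {M M' P P' Q Q' : Matrix (Fin n) (Fin n) ℝ}

theorem one : HadDominated (1 : Matrix (Fin n) (Fin n) ℝ) 1 1 := by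
  constructor <;> intro x y <;> rw [Matrix.one_apply] <;> split_ifs <;> simp

theorem mul (h : HadDominated M P Q) (h' : HadDominated M' P' Q') :
    HadDominated (M * M') (P * P') (Q * Q') where
  nonneg x y := by
    rw [Matrix.mul_apply]
    exact Finset.sum_nonneg fun z _ => mul_nonneg (h.nonneg x z) (h'.nonneg z y)
  nonneg_left x y := by
    rw [Matrix.mul_apply]
    exact Finset.sum_nonneg fun z _ => mul_nonneg (h.nonneg_left x z) (h'.nonneg_left z y)
  nonneg_right x y := by
    rw [Matrix.mul_apply]
    exact Finset.sum_nonneg fun z _ => mul_nonneg (h.nonneg_right x z) (h'.nonneg_right z y)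
  sq_le x y := by
    simp only [Matrix.mul_apply]
    refine Finset.sum_sq_le_sum_mul_sum_of_sq_le_mul _
      (fun z _ => mul_nonneg (h.nonneg_left x z) (h'.nonneg_left z y))
      (fun z _ => mul_nonneg (h.nonneg_right x z) (h'.nonneg_right z y)) fun z _ => ?_
    calc (M x z * M' z y) ^ 2 = M x z ^ 2 * M' z y ^ 2 := mul_pow _ _ _
      _ ≤ (P x z * Q x z) * (P' z y * Q' z y) :=
        mul_le_mul (h.sq_le x z) (h'.sq_le z y) (sq_nonneg _)
          (mul_nonneg (h.nonneg_left x z) (h.nonneg_right x z))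
      _ = P x z * P' z y * (Q x z * Q' z y) := by ring

theorem pow (h : HadDominated M P Q) (j : ℕ) : HadDominated (M ^ j) (P ^ j) (Q ^ j) := by
  induction j with
  | zero => simpa using one
  | succ j ih => simpa only [pow_succ] using ih.mul h

section Norm

attribute [local instance] Matrix.linftyOpNormedRing Matrix.linftyOpNormedAlgebra

theorem nnnorm_sq_le (h : HadDominated M P Q) :
    ‖M.map (fun x => (x : ℂ))‖₊ ^ 2 ≤
      ‖P.map (fun x => (x : ℂ))‖₊ * ‖Q.map (fun x => (x : ℂ))‖₊ := by
  rw [← NNReal.le_sqrt_iff_sq_le, Matrix.linfty_opNNNorm_def]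
  refine Finset.sup_le fun x _ => ?_
  rw [NNReal.le_sqrt_iff_sq_le]
  refine le_trans ?_ (mul_le_mul' (row_sum_le_nnnorm P x) (row_sum_le_nnnorm Q x))
  refine Finset.sum_sq_le_sum_mul_sum_of_sq_le_mul _ (fun _ _ => zero_le) (fun _ _ => zero_le)
    fun y _ => ?_
  rw [← NNReal.coe_le_coe]
  simpa [abs_of_nonneg (h.nonneg_left x y), abs_of_nonneg (h.nonneg_right x y)]
    using h.sq_le x y

theorem specRad_sq_le (h : HadDominated M P Q) :
    specRad M ^ 2 ≤ specRad P * specRad Q := by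
  have lim (A : Matrix (Fin n) (Fin n) ℝ) :=
    spectrum.pow_nnnorm_pow_one_div_tendsto_nhds_spectralRadius (A.map (fun x => (x : ℂ)))
  refine le_of_tendsto_of_tendsto' (((ENNReal.continuous_pow 2).tendsto _).comp (lim M))
    (ENNReal.Tendsto.mul (lim P) (Or.inr (specRad_ne_top Q)) (lim Q)
      (Or.inr (specRad_ne_top P))) fun j => ?_
  have hj : (0 : ℝ) ≤ 1 / j := by positivity
  rw [Function.comp_apply, ← ENNReal.mul_rpow_of_nonneg _ _ hj, ← ENNReal.rpow_natCast,
    ← ENNReal.rpow_mul, mul_comm, ENNReal.rpow_mul, ENNReal.rpow_natCast]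
  refine ENNReal.rpow_le_rpow ?_ hj
  simp only [← map_ofReal_pow]
  exact_mod_cast (h.pow j).nnnorm_sq_le

end Norm

theorem exists_mem_pow {R T U : Set (Matrix (Fin n) (Fin n) ℝ)}
    (h : ∀ X ∈ R, ∃ P ∈ T, ∃ Q ∈ U, HadDominated X P Q) (k : ℕ) :
    ∀ X ∈ R ^ k, ∃ P ∈ T ^ k, ∃ Q ∈ U ^ k, HadDominated X P Q := by
  induction k with
  | zero => simpa using one
  | succ k ih =>
    intro X hX
    rw [pow_succ] at hX
    obtain ⟨Y, hY, Z, hZ, rfl⟩ := hX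
    obtain ⟨P, hP, Q, hQ, hY⟩ := ih Y hY
    obtain ⟨P', hP', Q', hQ', hZ⟩ := h Z hZ
    exact ⟨P * P', pow_succ T k ▸ Set.mul_mem_mul hP hP',
      Q * Q', pow_succ U k ▸ Set.mul_mem_mul hQ hQ', hY.mul hZ⟩

theorem hadGeomMean {A B : Matrix (Fin n) (Fin n) ℝ} (hA : ∀ x y, 0 ≤ A x y)
    (hB : ∀ x y, 0 ≤ B x y) :
    HadDominated
      (Matrix.of fun x y => (A x y) ^ ((1 : ℝ) / 2) * (B x y) ^ ((1 : ℝ) / 2)) A B where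
  nonneg x y := mul_nonneg (Real.rpow_nonneg (hA x y) _) (Real.rpow_nonneg (hB x y) _)
  nonneg_left := hA
  nonneg_right := hB
  sq_le x y := by
    simp only [Matrix.of_apply, ← Real.sqrt_eq_rpow, mul_pow, Real.sq_sqrt (hA x y),
      Real.sq_sqrt (hB x y), le_refl]

theorem symm (h : HadDominated M P Q) : HadDominated M Q P :=
  ⟨h.nonneg, h.nonneg_right, h.nonneg_left, fun x y => mul_comm (P x y) _ ▸ h.sq_le x y⟩

end HadDominated

theorem exists_specRad_le_of_mem_mul_pow {n : ℕ} {Ψ S : Set (Matrix (Fin n) (Fin n) ℝ)} {k : ℕ}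
    (hk : k ≠ 0) {Q : Matrix (Fin n) (Fin n) ℝ} (hQ : Q ∈ (S * Ψ) ^ k) :
    ∃ Q' ∈ (Ψ * S) ^ k, specRad Q ≤ specRad Q' := by
  obtain ⟨m, rfl⟩ := Nat.exists_eq_succ_of_ne_zero hk
  rw [Nat.succ_eq_add_one, pow_succ, ← mul_assoc, mul_pow_mul] at hQ
  obtain ⟨X, ⟨b, hb, W, hW, rfl⟩, a, ha, rfl⟩ := hQ
  refine ⟨a * (b * W), ?_, specRad_mul_comm_le _ _⟩
  rw [Nat.succ_eq_add_one, pow_succ', mul_assoc]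
  exact Set.mul_mem_mul ha (Set.mul_mem_mul hb hW)

theorem specRad_le_iSup_rpow_of_mem_setHadGeomMeanTwo_pow {n : ℕ}
    {Ψ S : Set (Matrix (Fin n) (Fin n) ℝ)}
    (hposΨ : ∀ B ∈ Ψ, ∀ x y, 0 ≤ B x y) (hposS : ∀ B ∈ S, ∀ x y, 0 ≤ B x y)
    {k : ℕ} (hk : k ≠ 0) {C : Matrix (Fin n) (Fin n) ℝ} (hC : C ∈ setHadGeomMeanTwo Ψ S ^ k) :
    specRad C ≤ (⨆ B ∈ (Ψ * S) ^ k, specRad B) ^ ((1 : ℝ) / 2) := by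
  have hpair : ∀ X ∈ setHadGeomMeanTwo Ψ S * setHadGeomMeanTwo Ψ S,
      ∃ P ∈ Ψ * S, ∃ Q ∈ S * Ψ, HadDominated X P Q := by
    rintro _ ⟨_, ⟨A, hA, B, hB, rfl⟩, _, ⟨A', hA', B', hB', rfl⟩, rfl⟩
    exact ⟨A * B', Set.mul_mem_mul hA hB', B * A', Set.mul_mem_mul hB hA',
      (HadDominated.hadGeomMean (hposΨ A hA) (hposS B hB)).mul
        (HadDominated.hadGeomMean (hposΨ A' hA') (hposS B' hB')).symm⟩
  have hCC : C ^ 2 ∈ (setHadGeomMeanTwo Ψ S * setHadGeomMeanTwo Ψ S) ^ k := by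
    rw [← sq, ← pow_mul, mul_comm, pow_mul]
    exact Set.pow_mem_pow hC
  obtain ⟨P, hP, Q, hQ, hdom⟩ := HadDominated.exists_mem_pow hpair k _ hCC
  obtain ⟨Q', hQ', hle⟩ := exists_specRad_le_of_mem_mul_pow hk hQ
  set s := ⨆ B ∈ (Ψ * S) ^ k, specRad B
  have hPs : specRad P ≤ s := le_iSup₂_of_le P hP le_rfl
  have hQs : specRad Q ≤ s := hle.trans (le_iSup₂_of_le Q' hQ' le_rfl)
  have h2 : specRad C ^ 2 ≤ specRad (C ^ 2) := by
    simp only [specRad, map_ofReal_pow]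
    exact spectrum.spectralRadius_pow_le _ 2 two_ne_zero
  have h4 : (specRad C ^ 2) ^ 2 ≤ s ^ 2 :=
    calc (specRad C ^ 2) ^ 2 ≤ specRad (C ^ 2) ^ 2 := by gcongr
      _ ≤ specRad P * specRad Q := hdom.specRad_sq_le
      _ ≤ s * s := mul_le_mul' hPs hQs
      _ = s ^ 2 := (sq s).symm
  have h : specRad C ^ 2 ≤ s := (ENNReal.pow_le_pow_left_iff two_ne_zero).1 h4
  rw [one_div, ENNReal.le_rpow_inv_iff two_pos]
  exact_mod_cast h

/-- Corollary 3.5 for bounded sets of non-negative matrices: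
`ρ(Ψ^(1/2) ∘ Σ^(1/2)) ≤ ρ(ΨΣ)^(1/2)`. -/
theorem genSpecRad_setHadGeomMean_two_le {n : ℕ} (hn : 0 < n)
    (Ψ S : Set (Matrix (Fin n) (Fin n) ℝ))
    (hneΨ : Ψ.Nonempty) (hneS : S.Nonempty)
    (hbddΨ : ∃ C : ℝ, ∀ B ∈ Ψ, opNorm B ≤ C)
    (hbddS : ∃ C : ℝ, ∀ B ∈ S, opNorm B ≤ C)
    (hposΨ : ∀ B ∈ Ψ, ∀ x y, 0 ≤ B x y)
    (hposS : ∀ B ∈ S, ∀ x y, 0 ≤ B x y) :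
    genSpecRad (setHadGeomMeanTwo Ψ S) ≤ genSpecRad (setMulTwo Ψ S) ^ ((1 : ℝ) / 2) := by
  have hhalf : (0 : ℝ) < 1 / 2 := by norm_num
  have hlim := (ENNReal.orderIsoRpow (1 / 2) hhalf).limsup_apply
    (f := Filter.atTop)
    (u := fun k : ℕ => (⨆ B ∈ setPow (setMulTwo Ψ S) k, specRad B) ^ (1 / (k : ℝ)))
  simp only [ENNReal.orderIsoRpow_apply] at hlim
  rw [genSpecRad, genSpecRad, hlim]
  refine Filter.limsup_le_limsup ?_
  filter_upwards [Filter.eventually_ne_atTop 0] with k hk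
  rw [← ENNReal.rpow_mul, mul_comm, ENNReal.rpow_mul]
  refine ENNReal.rpow_le_rpow ?_ (by positivity)
  simp only [setPow_eq_pow, setMulTwo_eq_mul]
  exact iSup₂_le fun C hC =>
    specRad_le_iSup_rpow_of_mem_setHadGeomMeanTwo_pow hposΨ hposS hk hC
end

section
/- Let n be a positive integer and let Ψ and Σ be nonempty bounded sets of n×n matrices with nonnegative real entries. Then ρ̂(Ψ^(1/2) ∘ Σ^(1/2)) ≤ ρ̂(ΨΣ)^{1/2}, where ρ̂ denotes the joint spectral radius of a set. -/
open scoped ENNReal NNReal BigOperators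

theorem opNorm_nonneg {n : ℕ} (A : Matrix (Fin n) (Fin n) ℝ) : 0 ≤ opNorm A :=
  norm_nonneg _

theorem norm_toEuclideanLin_le {n : ℕ} (A : Matrix (Fin n) (Fin n) ℝ)
    (v : EuclideanSpace ℝ (Fin n)) : ‖Matrix.toEuclideanLin A v‖ ≤ opNorm A * ‖v‖ :=
  (LinearMap.toContinuousLinearMap (Matrix.toEuclideanLin A)).le_opNorm v

theorem opNorm_mul_le {n : ℕ} (A B : Matrix (Fin n) (Fin n) ℝ) :
    opNorm (A * B) ≤ opNorm A * opNorm B := by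
  open scoped Matrix.Norms.L2Operator in
  exact Matrix.l2_opNorm_mul A B

theorem opNorm_one_le {n : ℕ} : opNorm (1 : Matrix (Fin n) (Fin n) ℝ) ≤ 1 := by
  refine ContinuousLinearMap.opNorm_le_bound _ zero_le_one fun v => ?_
  simp [Matrix.toLpLin_one]

/-- The entrywise Cauchy-Schwarz inequality `(∑ C_j v_j)² ≤ (∑ P_j |v_j|) (∑ Q_j |v_j|)`. -/
theorem sq_sum_mul_le_of_sq_le {ι : Type*} (s : Finset ι) {C P Q v : ι → ℝ}
    (hP : ∀ j, 0 ≤ P j) (hQ : ∀ j, 0 ≤ Q j) (h : ∀ j, C j ^ 2 ≤ P j * Q j) :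
    (∑ j ∈ s, C j * v j) ^ 2 ≤ (∑ j ∈ s, P j * |v j|) * ∑ j ∈ s, Q j * |v j| := by
  refine Finset.sum_sq_le_sum_mul_sum_of_sq_le_mul s
    (fun j _ => mul_nonneg (hP j) (abs_nonneg _)) (fun j _ => mul_nonneg (hQ j) (abs_nonneg _))
    fun j _ => ?_
  calc (C j * v j) ^ 2 = C j ^ 2 * |v j| ^ 2 := by rw [mul_pow, sq_abs]
    _ ≤ P j * Q j * |v j| ^ 2 := by gcongr; exact h j
    _ = _ := by ring

theorem opNorm_le_of_sq_le_mul {n : ℕ} {C P Q : Matrix (Fin n) (Fin n) ℝ} {c : ℝ}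
    (hP : ∀ x y, 0 ≤ P x y) (hQ : ∀ x y, 0 ≤ Q x y)
    (h : ∀ x y, C x y ^ 2 ≤ P x y * Q x y) (hPc : opNorm P ≤ c) (hQc : opNorm Q ≤ c) :
    opNorm C ≤ c := by
  have hc : 0 ≤ c := (opNorm_nonneg P).trans hPc
  refine ContinuousLinearMap.opNorm_le_bound _ hc fun v => ?_
  let w : EuclideanSpace ℝ (Fin n) := WithLp.toLp 2 fun j => |v j|
  have hw : ‖w‖ = ‖v‖ := by simp [EuclideanSpace.norm_eq, w]
  have bound (A : Matrix (Fin n) (Fin n) ℝ) (hA : opNorm A ≤ c) :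
      ∑ i, (∑ j, A i j * |v j|) ^ 2 ≤ (c * ‖v‖) ^ 2 := by
    have h1 : ‖Matrix.toEuclideanLin A w‖ ≤ c * ‖v‖ := by
      refine (norm_toEuclideanLin_le A w).trans ?_
      rw [hw]
      gcongr
    have h2 := pow_le_pow_left₀ (norm_nonneg _) h1 2
    rw [EuclideanSpace.real_norm_sq_eq] at h2
    simpa [Matrix.toLpLin_apply, Matrix.mulVec, dotProduct, w] using h2
  refine le_of_sq_le_sq ?_ (by positivity)
  change ‖Matrix.toEuclideanLin C v‖ ^ 2 ≤ _
  rw [EuclideanSpace.real_norm_sq_eq]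
  calc ∑ i, (Matrix.toEuclideanLin C v) i ^ 2
      = ∑ i, (∑ j, C i j * v j) ^ 2 := by
        simp [Matrix.toLpLin_apply, Matrix.mulVec, dotProduct]
    _ ≤ ∑ i, ((∑ j, P i j * |v j|) ^ 2 + (∑ j, Q i j * |v j|) ^ 2) / 2 := by
        refine Finset.sum_le_sum fun i _ => ?_
        have h1 := sq_sum_mul_le_of_sq_le Finset.univ (v := v) (hP i) (hQ i) (h i)
        have h2 := two_mul_le_add_sq (∑ j, P i j * |v j|) (∑ j, Q i j * |v j|)
        linarith
    _ ≤ (c * ‖v‖) ^ 2 := by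
        rw [← Finset.sum_div, Finset.sum_add_distrib]
        linarith [bound P hPc, bound Q hQc]

/-- The set of alternating products `A₁ B₂ A₃ B₄ ⋯` with `m` factors, where `Aᵢ ∈ Ψ`, `Bᵢ ∈ S`. -/
def altProd {n : ℕ} : ℕ → Set (Matrix (Fin n) (Fin n) ℝ) → Set (Matrix (Fin n) (Fin n) ℝ) →
    Set (Matrix (Fin n) (Fin n) ℝ)
  | 0, _, _ => {1}
  | m + 1, Ψ, S => setMulTwo Ψ (altProd m S Ψ)

theorem one_mem_setPow_zero {n : ℕ} (S : Set (Matrix (Fin n) (Fin n) ℝ)) : 1 ∈ setPow S 0 :=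
  ⟨Fin.elim0, fun i => i.elim0, by simp [matListProd]⟩

theorem mul_mem_setPow_succ {n k : ℕ} {S : Set (Matrix (Fin n) (Fin n) ℝ)}
    {A Y : Matrix (Fin n) (Fin n) ℝ} (hA : A ∈ S) (hY : Y ∈ setPow S k) :
    A * Y ∈ setPow S (k + 1) := by
  obtain ⟨B, hB, rfl⟩ := hY
  exact ⟨Fin.cons A B, Fin.cases hA hB, by simp [matListProd]⟩

theorem exists_of_mem_setPow_succ {n k : ℕ} {S : Set (Matrix (Fin n) (Fin n) ℝ)}
    {X : Matrix (Fin n) (Fin n) ℝ} (hX : X ∈ setPow S (k + 1)) :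
    ∃ A ∈ S, ∃ Y ∈ setPow S k, X = A * Y := by
  obtain ⟨B, hB, rfl⟩ := hX
  exact ⟨B 0, hB 0, _, ⟨fun i => B i.succ, fun i => hB _, rfl⟩, by simp [matListProd]⟩

theorem mul_apply_nonneg {n : ℕ} {A B : Matrix (Fin n) (Fin n) ℝ} (hA : ∀ x y, 0 ≤ A x y)
    (hB : ∀ x y, 0 ≤ B x y) (x y : Fin n) : 0 ≤ (A * B) x y := by
  rw [Matrix.mul_apply]
  exact Finset.sum_nonneg fun z _ => mul_nonneg (hA x z) (hB z y)

theorem exists_altProd_of_mem_setPow {n : ℕ} {Ψ S : Set (Matrix (Fin n) (Fin n) ℝ)}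
    (hΨ : ∀ B ∈ Ψ, ∀ x y, 0 ≤ B x y) (hS : ∀ B ∈ S, ∀ x y, 0 ≤ B x y) (m : ℕ)
    (X : Matrix (Fin n) (Fin n) ℝ) (hX : X ∈ setPow (setHadGeomMeanTwo Ψ S) m) :
    ∃ P ∈ altProd m Ψ S, ∃ Q ∈ altProd m S Ψ, (∀ x y, 0 ≤ P x y) ∧ (∀ x y, 0 ≤ Q x y) ∧
      ∀ x y, X x y ^ 2 ≤ P x y * Q x y := by
  induction m generalizing X with
  | zero =>
    obtain ⟨A, -, rfl⟩ := hX
    have h1 (x y : Fin n) : 0 ≤ (1 : Matrix (Fin n) (Fin n) ℝ) x y := by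
      rw [Matrix.one_apply]; split_ifs <;> norm_num
    exact ⟨1, rfl, 1, rfl, h1, h1, fun x y => by simp [matListProd, sq]⟩
  | succ m ih =>
    obtain ⟨_, ⟨A, hA, B, hB, rfl⟩, Y, hY, rfl⟩ := exists_of_mem_setPow_succ hX
    obtain ⟨P, hP, Q, hQ, hP0, hQ0, hYPQ⟩ := ih Y hY
    refine ⟨A * Q, ⟨A, hA, Q, hQ, rfl⟩, B * P, ⟨B, hB, P, hP, rfl⟩,
      mul_apply_nonneg (hΨ A hA) hQ0,
      mul_apply_nonneg (hS B hB) hP0, fun x y => ?_⟩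
    simp only [Matrix.mul_apply, Matrix.of_apply]
    refine Finset.sum_sq_le_sum_mul_sum_of_sq_le_mul _
      (fun z _ => mul_nonneg (hΨ A hA x z) (hQ0 z y))
      (fun z _ => mul_nonneg (hS B hB x z) (hP0 z y)) fun z _ => ?_
    have hA0 := hΨ A hA x z
    have hB0 := hS B hB x z
    rw [← Real.sqrt_eq_rpow, ← Real.sqrt_eq_rpow, mul_pow, mul_pow, Real.sq_sqrt hA0,
      Real.sq_sqrt hB0]
    calc A x z * B x z * Y z y ^ 2 ≤ A x z * B x z * (P z y * Q z y) := by
          gcongr; exact hYPQ z y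
      _ = _ := by ring

theorem exists_setPow_of_mem_altProd {n : ℕ} {Ψ S : Set (Matrix (Fin n) (Fin n) ℝ)} {K : ℝ}
    (hK : 1 ≤ K) (hΨ : ∀ B ∈ Ψ, opNorm B ≤ K) (m : ℕ)
    (X : Matrix (Fin n) (Fin n) ℝ) (hX : X ∈ altProd m Ψ S) :
    ∃ Y ∈ setPow (setMulTwo Ψ S) (m / 2), ∃ Z, opNorm Z ≤ K ∧ X = Y * Z := by
  induction m using Nat.twoStepInduction generalizing X with
  | zero =>
    obtain rfl : X = 1 := hX
    exact ⟨1, one_mem_setPow_zero _, 1, opNorm_one_le.trans hK, by simp⟩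
  | one =>
    obtain ⟨A, hA, _, rfl, rfl⟩ := hX
    exact ⟨1, one_mem_setPow_zero _, A, hΨ A hA, by simp⟩
  | more m ih _ =>
    obtain ⟨A, hA, _, ⟨B, hB, W, hW, rfl⟩, rfl⟩ := hX
    obtain ⟨Y, hY, Z, hZ, rfl⟩ := ih W hW
    rw [show (m + 2) / 2 = m / 2 + 1 by omega]
    exact ⟨A * B * Y, mul_mem_setPow_succ ⟨A, hA, B, hB, rfl⟩ hY, Z, hZ, by simp [mul_assoc]⟩

theorem pow_div_two_le {t : ℝ} (ht : 0 < t) (m : ℕ) :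
    (t ^ 2) ^ (m / 2) ≤ (1 + 1 / t) * t ^ m := by
  rw [← pow_mul]
  have hm : 0 < t ^ m := by positivity
  rcases Nat.even_or_odd m with h | ⟨k, rfl⟩
  · rw [Nat.two_mul_div_two_of_even h]
    have : 0 ≤ 1 / t * t ^ m := by positivity
    linarith
  · rw [show 2 * ((2 * k + 1) / 2) = 2 * k by omega, pow_succ]
    have : (1 + 1 / t) * (t ^ (2 * k) * t) = t ^ (2 * k) * t + t ^ (2 * k) := by field_simp
    have : 0 ≤ t ^ (2 * k) * t := by positivity
    linarith

theorem jointSpecRad_le_of_eventually_le {n : ℕ} {T : Set (Matrix (Fin n) (Fin n) ℝ)} {L t : ℝ}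
    (hL : 0 < L) (ht : 0 ≤ t)
    (h : ∀ᶠ m in Filter.atTop, ∀ X ∈ setPow T m, opNorm X ≤ L * t ^ m) :
    jointSpecRad T ≤ ENNReal.ofReal t := by
  have hlim : Filter.Tendsto (fun m : ℕ => ENNReal.ofReal (L ^ (1 / (m : ℝ)) * t)) Filter.atTop
      (nhds (ENNReal.ofReal t)) := by
    refine ENNReal.tendsto_ofReal ?_
    have h1 : Filter.Tendsto (fun m : ℕ => L ^ (1 / (m : ℝ))) Filter.atTop (nhds (L ^ (0 : ℝ))) :=
      tendsto_const_nhds.rpow tendsto_one_div_atTop_nhds_zero_nat (Or.inl hL.ne')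
    simpa using h1.mul_const t
  rw [← hlim.limsup_eq]
  refine Filter.limsup_le_limsup ?_
  filter_upwards [h, Filter.eventually_gt_atTop 0] with m hm hm0
  have hsup : (⨆ B ∈ setPow T m, ENNReal.ofReal (opNorm B)) ≤ ENNReal.ofReal (L * t ^ m) :=
    iSup₂_le fun X hX => ENNReal.ofReal_le_ofReal (hm X hX)
  refine (ENNReal.rpow_le_rpow hsup (by positivity)).trans_eq ?_
  rw [ENNReal.ofReal_rpow_of_nonneg (by positivity) (by positivity),
    Real.mul_rpow hL.le (by positivity), one_div, Real.pow_rpow_inv_natCast ht hm0.ne']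

theorem eventually_opNorm_le_of_jointSpecRad_lt {n : ℕ} {T : Set (Matrix (Fin n) (Fin n) ℝ)}
    {s : ℝ} (hs : 0 ≤ s) (h : jointSpecRad T < ENNReal.ofReal s) :
    ∀ᶠ k in Filter.atTop, ∀ X ∈ setPow T k, opNorm X ≤ s ^ k := by
  filter_upwards [Filter.eventually_lt_of_limsup_lt h, Filter.eventually_gt_atTop 0]
    with k hk hk0 X hX
  have hk' : (0 : ℝ) < k := by exact_mod_cast hk0
  rw [one_div, ENNReal.rpow_inv_lt_iff hk', ENNReal.rpow_natCast, ← ENNReal.ofReal_pow hs] at hk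
  exact (ENNReal.ofReal_le_ofReal_iff (by positivity)).1
    ((le_iSup₂ (f := fun B (_ : B ∈ setPow T k) => ENNReal.ofReal (opNorm B)) X hX).trans hk.le)

/-- Corollary 3.5 for bounded sets of non-negative matrices:
`ρ̂(Ψ^(1/2) ∘ Σ^(1/2)) ≤ ρ̂(ΨΣ)^(1/2)`. -/
theorem jointSpecRad_setHadGeomMean_two_le {n : ℕ} (hn : 0 < n)
    (Ψ S : Set (Matrix (Fin n) (Fin n) ℝ))
    (hneΨ : Ψ.Nonempty) (hneS : S.Nonempty)
    (hbddΨ : ∃ C : ℝ, ∀ B ∈ Ψ, opNorm B ≤ C)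
    (hbddS : ∃ C : ℝ, ∀ B ∈ S, opNorm B ≤ C)
    (hposΨ : ∀ B ∈ Ψ, ∀ x y, 0 ≤ B x y)
    (hposS : ∀ B ∈ S, ∀ x y, 0 ≤ B x y) :
    jointSpecRad (setHadGeomMeanTwo Ψ S) ≤ jointSpecRad (setMulTwo Ψ S) ^ ((1 : ℝ) / 2) := by
  obtain ⟨C₁, hC₁⟩ := hbddΨ
  obtain ⟨C₂, hC₂⟩ := hbddS
  obtain ⟨K, hK, hKΨ, hKS⟩ :
      ∃ K : ℝ, 1 ≤ K ∧ (∀ B ∈ Ψ, opNorm B ≤ K) ∧ ∀ B ∈ S, opNorm B ≤ K :=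
    ⟨max 1 (max C₁ C₂), le_max_left _ _, fun B hB => (hC₁ B hB).trans (by simp),
      fun B hB => (hC₂ B hB).trans (by simp)⟩
  refine le_of_forall_gt_imp_ge_of_dense fun u hu => ?_
  rcases eq_or_ne u ⊤ with rfl | hu_top
  · exact le_top
  obtain ⟨t, ht, rfl⟩ : ∃ t : ℝ, 0 < t ∧ u = ENNReal.ofReal t :=
    ⟨u.toReal, ENNReal.toReal_pos (pos_of_gt hu).ne' hu_top, (ENNReal.ofReal_toReal hu_top).symm⟩
  have hlt : jointSpecRad (setMulTwo Ψ S) < ENNReal.ofReal (t ^ 2) := by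
    rw [one_div, ENNReal.rpow_inv_lt_iff two_pos, ENNReal.rpow_two] at hu
    rwa [ENNReal.ofReal_pow ht.le]
  obtain ⟨N, hN⟩ := Filter.eventually_atTop.1
    (eventually_opNorm_le_of_jointSpecRad_lt (by positivity) hlt)
  have halt (m : ℕ) (hm : 2 * N ≤ m) (X : Matrix (Fin n) (Fin n) ℝ) (hX : X ∈ altProd m Ψ S) :
      opNorm X ≤ K * (1 + 1 / t) * t ^ m := by
    obtain ⟨Y, hY, Z, hZ, rfl⟩ := exists_setPow_of_mem_altProd hK hKΨ m X hX
    calc opNorm (Y * Z) ≤ opNorm Y * opNorm Z := opNorm_mul_le Y Z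
      _ ≤ ((1 + 1 / t) * t ^ m) * K := by
          refine mul_le_mul ((hN (m / 2) (by omega) Y hY).trans (pow_div_two_le ht m)) hZ
            (opNorm_nonneg Z) (by positivity)
      _ = _ := by ring
  have hK0 : 0 < K := by linarith
  have hKt : 0 < K / t := by positivity
  refine jointSpecRad_le_of_eventually_le (L := K * (1 + 1 / t) * (1 + K / t)) (by positivity)
    ht.le ?_
  filter_upwards [Filter.eventually_ge_atTop (2 * N + 1)] with m hm X hX
  obtain ⟨P, hP, Q, hQ, hP0, hQ0, hPQ⟩ := exists_altProd_of_mem_setPow hposΨ hposS m X hX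
  refine opNorm_le_of_sq_le_mul hP0 hQ0 hPQ ?_ ?_
  · refine (halt m (by omega) P hP).trans ?_
    refine mul_le_mul_of_nonneg_right ?_ (by positivity)
    exact le_mul_of_one_le_right (by positivity) (le_add_of_nonneg_right hKt.le)
  · obtain ⟨m, rfl⟩ : ∃ j, m = j + 1 := ⟨m - 1, by omega⟩
    obtain ⟨B, hB, W, hW, rfl⟩ := hQ
    calc opNorm (B * W) ≤ opNorm B * opNorm W := opNorm_mul_le B W
      _ ≤ K * (K * (1 + 1 / t) * t ^ m) :=
          mul_le_mul (hKS B hB) (halt m (by omega) W hW) (opNorm_nonneg W) hK0.le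
      _ = K * (1 + 1 / t) * (K / t) * t ^ (m + 1) := by field_simp; ring
      _ ≤ _ := by
          gcongr
          linarith
end
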